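/- (Proposition 1) There exists exactly one configuration conforming to the connector motif (n, m, d) if and only if for every port type p we have m p ≤ n p and n p * d p = m p * ∏_{q : P} C(n q, m q), where C denotes the binomial coefficient (equivalently, the matching factor s p = n p * d p / m p equals the maximum number of distinct connectors the motif defines). -/

import Mathlib

/-- A configuration `γ` (a finset of connectors) conforms to the connector motif `(n, m, d)`
if it is nonempty, every connector `k ∈ γ` has exactly `m p` instances of each port type `p`,
and every instance `i : Fin (n p)` of each port type `p` belongs to exactly `d p`
connectors of `γ`. -/
def Conforms {P : Type*} [Fintype P] [DecidableEq P] (n m d : P → ℕ)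
    (γ : Finset ((p : P) → Finset (Fin (n p)))) : Prop :=
  γ.Nonempty ∧
    (∀ k ∈ γ, ∀ p : P, (k p).card = m p) ∧
    (∀ (p : P) (i : Fin (n p)), (γ.filter fun k => i ∈ k p).card = d p)

/-- Relabelling the instances of every port type by permutations, as a permutation of the
connectors. -/
def relabel {P : Type*} {n : P → ℕ} (σ : (p : P) → Equiv.Perm (Fin (n p))) :
    Equiv.Perm ((p : P) → Finset (Fin (n p))) :=
  Equiv.piCongrRight fun p => (σ p).finsetCongr

theorem relabel_apply {P : Type*} {n : P → ℕ} (σ : (p : P) → Equiv.Perm (Fin (n p)))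
    (k : (p : P) → Finset (Fin (n p))) (p : P) :
    relabel σ k p = (k p).map (σ p).toEmbedding := rfl

theorem card_filter_mem_map_relabel {P : Type*} {n : P → ℕ}
    (σ : (p : P) → Equiv.Perm (Fin (n p)))
    (γ : Finset ((p : P) → Finset (Fin (n p)))) (p : P) (i : Fin (n p)) :
    ((γ.map (relabel σ).toEmbedding).filter fun k => σ p i ∈ k p).card =
      (γ.filter fun k => i ∈ k p).card := by
  rw [Finset.filter_map, Finset.card_map]
  congr 1
  ext k
  simp [relabel_apply]

theorem Conforms.map_relabel {P : Type*} [Fintype P] [DecidableEq P] {n m d : P → ℕ}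
    {γ : Finset ((p : P) → Finset (Fin (n p)))} (h : Conforms n m d γ)
    (σ : (p : P) → Equiv.Perm (Fin (n p))) :
    Conforms n m d (γ.map (relabel σ).toEmbedding) := by
  obtain ⟨hne, hcard, hdeg⟩ := h
  refine ⟨hne.map, ?_, fun p i => ?_⟩
  · intro k hk p
    obtain ⟨k', hk', rfl⟩ := Finset.mem_map.1 hk
    simpa [relabel_apply] using hcard k' hk' p
  · obtain ⟨j, rfl⟩ := (σ p).surjective i
    rw [card_filter_mem_map_relabel, hdeg]

/-- All connectors with the prescribed multiplicities. -/
def allConnectors {P : Type*} [Fintype P] [DecidableEq P] (n m : P → ℕ) :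
    Finset ((p : P) → Finset (Fin (n p))) :=
  Fintype.piFinset fun p => Finset.powersetCard (m p) Finset.univ

theorem mem_allConnectors {P : Type*} [Fintype P] [DecidableEq P] {n m : P → ℕ}
    {k : (p : P) → Finset (Fin (n p))} :
    k ∈ allConnectors n m ↔ ∀ p, (k p).card = m p := by
  simp [allConnectors, Finset.mem_powersetCard]

theorem card_allConnectors {P : Type*} [Fintype P] [DecidableEq P] (n m : P → ℕ) :
    (allConnectors n m).card = ∏ q : P, (n q).choose (m q) := by
  simp [allConnectors]

theorem map_relabel_allConnectors {P : Type*} [Fintype P] [DecidableEq P] (n m : P → ℕ)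
    (σ : (p : P) → Equiv.Perm (Fin (n p))) :
    (allConnectors n m).map (relabel σ).toEmbedding = allConnectors n m := by
  refine Finset.eq_of_subset_of_card_le (fun k hk => ?_) (by simp)
  obtain ⟨k', hk', rfl⟩ := Finset.mem_map.1 hk
  simpa [mem_allConnectors, relabel_apply] using hk'

theorem sum_card_filter_mem {P : Type*} {n m : P → ℕ}
    {γ : Finset ((p : P) → Finset (Fin (n p)))} (p : P) (h : ∀ k ∈ γ, (k p).card = m p) :
    ∑ i : Fin (n p), (γ.filter fun k => i ∈ k p).card = m p * γ.card := by
  simp_rw [Finset.card_filter]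
  rw [Finset.sum_comm]
  simp only [← Finset.card_filter, Finset.filter_univ_mem]
  rw [Finset.sum_congr rfl h, Finset.sum_const, smul_eq_mul, mul_comm]

theorem Conforms.mul_degree {P : Type*} [Fintype P] [DecidableEq P] {n m d : P → ℕ}
    {γ : Finset ((p : P) → Finset (Fin (n p)))} (h : Conforms n m d γ) (p : P) :
    n p * d p = m p * γ.card := by
  rw [← sum_card_filter_mem p fun k hk => h.2.1 k hk p]
  simp [h.2.2 p]

theorem Conforms.subset_allConnectors {P : Type*} [Fintype P] [DecidableEq P] {n m d : P → ℕ}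
    {γ : Finset ((p : P) → Finset (Fin (n p)))} (h : Conforms n m d γ) :
    γ ⊆ allConnectors n m :=
  fun k hk => mem_allConnectors.2 (h.2.1 k hk)

theorem exists_perm_map_eq {α : Type*} [Fintype α] [DecidableEq α] {s t : Finset α}
    (h : s.card = t.card) : ∃ σ : Equiv.Perm α, s.map σ.toEmbedding = t := by
  let e : {x // x ∈ s} ≃ {x // x ∈ t} := Finset.equivOfCardEq h
  refine ⟨e.extendSubtype, Finset.eq_of_subset_of_card_le (fun x hx => ?_) (by simp [h])⟩
  obtain ⟨y, hy, rfl⟩ := Finset.mem_map.1 hx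
  exact e.extendSubtype_mem y hy

/-- Relabellings act transitively on connectors with prescribed multiplicities. -/
theorem exists_relabel_eq {P : Type*} {n : P → ℕ} {k l : (p : P) → Finset (Fin (n p))}
    (h : ∀ p, (k p).card = (l p).card) :
    ∃ σ : (p : P) → Equiv.Perm (Fin (n p)), relabel σ k = l := by
  choose σ hσ using fun p => exists_perm_map_eq (h p)
  exact ⟨σ, funext hσ⟩

theorem card_filter_mem_allConnectors {P : Type*} [Fintype P] [DecidableEq P] (n m : P → ℕ)
    (p : P) (i j : Fin (n p)) :
    ((allConnectors n m).filter fun k => i ∈ k p).card =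
      ((allConnectors n m).filter fun k => j ∈ k p).card := by
  have h := card_filter_mem_map_relabel
    (Function.update (fun _ => 1) p (Equiv.swap i j)) (allConnectors n m) p i
  rw [map_relabel_allConnectors] at h
  simpa using h.symm

theorem conforms_allConnectors {P : Type*} [Fintype P] [DecidableEq P] {n m d : P → ℕ}
    (h : ∀ p, m p ≤ n p ∧ n p * d p = m p * ∏ q : P, (n q).choose (m q)) :
    Conforms n m d (allConnectors n m) := by
  refine ⟨?_, fun k hk => mem_allConnectors.1 hk, fun p i => ?_⟩
  · rw [← Finset.card_pos, card_allConnectors]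
    exact Finset.prod_pos fun q _ => Nat.choose_pos (h q).1
  · have hs := sum_card_filter_mem p
      fun k (hk : k ∈ allConnectors n m) => mem_allConnectors.1 hk p
    rw [Finset.sum_congr rfl fun j _ => card_filter_mem_allConnectors n m p j i,
      card_allConnectors, ← (h p).2] at hs
    simp only [Finset.sum_const, Finset.card_univ, Fintype.card_fin, smul_eq_mul] at hs
    exact Nat.eq_of_mul_eq_mul_left i.pos hs

theorem stmt_12 {P : Type*} [Fintype P] [DecidableEq P] (n m d : P → ℕ)
    (hm : ∀ p, 0 < m p) :
    (∃! γ : Finset ((p : P) → Finset (Fin (n p))), Conforms n m d γ) ↔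
      ∀ p : P, m p ≤ n p ∧ n p * d p = m p * ∏ q : P, (n q).choose (m q) := by
  constructor
  · rintro ⟨γ, hγ, huniq⟩ p
    have hall : γ = allConnectors n m := by
      refine hγ.subset_allConnectors.antisymm fun l hl => ?_
      obtain ⟨k, hk⟩ := hγ.1
      obtain ⟨σ, rfl⟩ := exists_relabel_eq (k := k) (l := l) fun p =>
        (hγ.2.1 k hk p).trans (mem_allConnectors.1 hl p).symm
      rw [← huniq _ (hγ.map_relabel σ)]
      exact Finset.mem_map_of_mem _ hk
    refine ⟨?_, ?_⟩
    · obtain ⟨k, hk⟩ := hγ.1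
      simpa [hγ.2.1 k hk p] using Finset.card_le_univ (k p)
    · rw [hγ.mul_degree p, hall, card_allConnectors]
  · intro h
    refine ⟨allConnectors n m, conforms_allConnectors h, fun γ hγ => ?_⟩
    refine Finset.eq_of_subset_of_card_le hγ.subset_allConnectors ?_
    rw [card_allConnectors]
    rcases isEmpty_or_nonempty P with hP | ⟨⟨p⟩⟩
    · simpa using hγ.1
    · exact (Nat.eq_of_mul_eq_mul_left (hm p) ((h p).2.symm.trans (hγ.mul_degree p))).le
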